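/- Let K be a field, let Δ and Γ be finite-dimensional K-algebras, and set Λ = Δ ⊗_K Γ. Let P be a finitely generated projective left Δ-module and let M be a finitely generated left Γ-module with a minimal projective presentation Q^{-1} →f Q^0 → M → 0. Then there is an isomorphism of left Λ-modules ker(ν_Λ(id_P ⊗ f)) ≅ ν_Δ(P) ⊗_K ker(ν_Γ(f)); that is, the Auslander–Reiten translate satisfies τ_Λ(P ⊗_K M) ≅ ν_Δ(P) ⊗_K τ_Γ(M). -/

import Mathlib

open TensorProduct

section TensorModule

variable (K : Type) [Field K]
variable (Γ : Type) [Ring Γ] [Algebra K Γ]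
variable (N : Type) [AddCommGroup N] [Module K N] [Module Γ N] [IsScalarTower K Γ N]

/-- Scalar multiplication by `γ` on a left `Γ`-module, as a `K`-linear map. -/
def lsmulK (γ : Γ) : N →ₗ[K] N where
  toFun n := γ • n
  map_add' := smul_add γ
  map_smul' k n := show γ • (k • n) = k • (γ • n) by
    rw [← algebraMap_smul Γ k n, ← mul_smul, ← Algebra.commutes k γ, mul_smul,
      algebraMap_smul]

variable (M : Type) [AddCommGroup M] [Module K M]

/-- The action of `Γ` on `M ⊗[K] N` through the right-hand factor. -/
noncomputable instance (priority := 50) TensorProduct.rightFactorModule :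
    Module Γ (M ⊗[K] N) where
  smul γ x := LinearMap.lTensor M (lsmulK K Γ N γ) x
  one_smul x := by
    show LinearMap.lTensor M (lsmulK K Γ N 1) x = x
    have h : lsmulK K Γ N (1 : Γ) = LinearMap.id := LinearMap.ext fun n => one_smul Γ n
    rw [h, LinearMap.lTensor_id, LinearMap.id_apply]
  mul_smul γ δ x := by
    show LinearMap.lTensor M (lsmulK K Γ N (γ * δ)) x =
      LinearMap.lTensor M (lsmulK K Γ N γ) (LinearMap.lTensor M (lsmulK K Γ N δ) x)
    have h : lsmulK K Γ N (γ * δ) = (lsmulK K Γ N γ).comp (lsmulK K Γ N δ) :=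
      LinearMap.ext fun n => mul_smul γ δ n
    rw [h, LinearMap.lTensor_comp, LinearMap.comp_apply]
  smul_zero γ := map_zero _
  smul_add γ x y := map_add _ x y
  add_smul γ δ x := by
    show LinearMap.lTensor M (lsmulK K Γ N (γ + δ)) x =
      LinearMap.lTensor M (lsmulK K Γ N γ) x + LinearMap.lTensor M (lsmulK K Γ N δ) x
    have h : lsmulK K Γ N (γ + δ) = lsmulK K Γ N γ + lsmulK K Γ N δ :=
      LinearMap.ext fun n => add_smul γ δ n
    rw [h, LinearMap.lTensor_add, LinearMap.add_apply]
  zero_smul x := by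
    show LinearMap.lTensor M (lsmulK K Γ N (0 : Γ)) x = 0
    have h : lsmulK K Γ N (0 : Γ) = 0 := LinearMap.ext fun n => zero_smul Γ n
    rw [h, LinearMap.lTensor_zero, LinearMap.zero_apply]

theorem rightFactor_smul_tmul (γ : Γ) (m : M) (n : N) :
    γ • (m ⊗ₜ[K] n) = m ⊗ₜ[K] (γ • n) := by
  show LinearMap.lTensor M (lsmulK K Γ N γ) (m ⊗ₜ[K] n) = m ⊗ₜ[K] (γ • n)
  rw [LinearMap.lTensor_tmul]; rfl

variable (Δ : Type) [Ring Δ] [Algebra K Δ] [Module Δ M] [IsScalarTower K Δ M]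

instance : SMulCommClass Δ Γ (M ⊗[K] N) where
  smul_comm δ γ x := by
    induction x using TensorProduct.induction_on with
    | zero => simp only [smul_zero]
    | tmul m n =>
        rw [rightFactor_smul_tmul, smul_tmul', smul_tmul', rightFactor_smul_tmul]
    | add x y hx hy => simp only [smul_add, hx, hy]

instance rightFactorTower : IsScalarTower K Γ (M ⊗[K] N) where
  smul_assoc k γ x := by
    induction x using TensorProduct.induction_on with
    | zero => simp only [smul_zero]
    | tmul m n =>
        rw [rightFactor_smul_tmul, rightFactor_smul_tmul, smul_assoc, smul_tmul']
        exact (smul_tmul k m (γ • n)).symm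
    | add x y hx hy => simp only [smul_add, hx, hy]

/-- The left `Δ ⊗[K] Γ`-module structure on `M ⊗[K] N`, characterized by
`(δ ⊗ γ) • (m ⊗ n) = (δ • m) ⊗ (γ • n)`. -/
noncomputable instance (priority := 2000) tensorTensorModule : Module (Δ ⊗[K] Γ) (M ⊗[K] N) :=
  @TensorProduct.Algebra.module K Δ Γ (M ⊗[K] N) _ _ _ _ _ _ _ _ _
    TensorProduct.isScalarTower_left (rightFactorTower K Γ N M) _

theorem tensorModule_smul_tmul (δ : Δ) (γ : Γ) (m : M) (n : N) :
    (δ ⊗ₜ[K] γ) • (m ⊗ₜ[K] n) = (δ • m) ⊗ₜ[K] (γ • n) := by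
  have h : (δ ⊗ₜ[K] γ) • (m ⊗ₜ[K] n) = δ • (γ • (m ⊗ₜ[K] n)) := rfl
  rw [h, rightFactor_smul_tmul, smul_tmul']

end TensorModule

section Nakayama

variable (K : Type) [Field K] (A : Type) [Ring A] [Algebra K A]
variable (M : Type) [AddCommGroup M] [Module A M]

instance (priority := 60) : SMulCommClass A K A :=
  ⟨fun a k x => (smul_comm k a x).symm⟩

instance (priority := 60) : SMulCommClass Aᵐᵒᵖ K A :=
  ⟨fun a k x => by
    rw [MulOpposite.smul_eq_mul_unop, MulOpposite.smul_eq_mul_unop, smul_mul_assoc]⟩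

/-- `Hom_K(Hom_A(M, A), K)`, the underlying space of the Nakayama functor `ν_A` applied
to a left `A`-module `M`. -/
abbrev nakayama : Type := (M →ₗ[A] A) →ₗ[K] K

/-- The action `f ↦ (op a) • f` (i.e. `f ↦ f · a`) on the right `A`-module
`Hom_A(M, A)`, as a `K`-linear map. -/
def opSmulHom (a : A) : (M →ₗ[A] A) →ₗ[K] (M →ₗ[A] A) where
  toFun f := MulOpposite.op a • f
  map_add' f g := smul_add _ f g
  map_smul' k f := smul_comm (MulOpposite.op a) k f

/-- The left `A`-module structure on `ν_A(M) = Hom_K(Hom_A(M, A), K)`, given by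
`(a • φ) f = φ (f · a)`. -/
instance nakayamaModule : Module A (nakayama K A M) where
  smul a φ := φ.comp (opSmulHom K A M a)
  one_smul φ := LinearMap.ext fun f => by
    show φ (MulOpposite.op (1 : A) • f) = φ f
    rw [MulOpposite.op_one, one_smul]
  mul_smul a b φ := LinearMap.ext fun f => by
    show φ (MulOpposite.op (a * b) • f) = φ (MulOpposite.op b • MulOpposite.op a • f)
    rw [← mul_smul, ← MulOpposite.op_mul]
  smul_zero a := LinearMap.ext fun f => rfl
  smul_add a φ ψ := LinearMap.ext fun f => rfl
  add_smul a b φ := LinearMap.ext fun f => by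
    show φ (MulOpposite.op (a + b) • f) =
      φ (MulOpposite.op a • f) + φ (MulOpposite.op b • f)
    rw [MulOpposite.op_add, add_smul, map_add]
  zero_smul φ := LinearMap.ext fun f => by
    show φ (MulOpposite.op (0 : A) • f) = 0
    rw [MulOpposite.op_zero, zero_smul, map_zero]

instance nakayamaTower : IsScalarTower K A (nakayama K A M) where
  smul_assoc k a φ := LinearMap.ext fun f => by
    show φ (MulOpposite.op (k • a) • f) = k • φ (MulOpposite.op a • f)
    have h : MulOpposite.op (k • a) • f = k • (MulOpposite.op a • f) := by
      rw [MulOpposite.op_smul, smul_assoc]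
    rw [h, map_smul]

variable {M} {N : Type} [AddCommGroup N] [Module A N]

/-- Precomposition with `g` on `Hom_A(-, A)`, as a `K`-linear map. -/
def precompHom (g : M →ₗ[A] N) : (N →ₗ[A] A) →ₗ[K] (M →ₗ[A] A) where
  toFun f := f.comp g
  map_add' f₁ f₂ := LinearMap.ext fun m => rfl
  map_smul' k f := LinearMap.ext fun m => rfl

/-- The Nakayama functor on morphisms: `ν_A(g) : ν_A(M) → ν_A(N)` for `g : M → N`. -/
def nakayamaMap (g : M →ₗ[A] N) : nakayama K A M →ₗ[A] nakayama K A N where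
  toFun φ := φ.comp (precompHom K A g)
  map_add' φ ψ := rfl
  map_smul' a φ := rfl

end Nakayama

open TensorProduct

/-- The radical `rad N = J(A)·N` of a left `A`-module `N`, where `J(A)` is the Jacobson
radical of `A` (the Jacobson radical of the zero ideal). -/
def radSubmodule (A : Type) [Ring A] (N : Type) [AddCommGroup N] [Module A N] :
    Submodule A N :=
  Submodule.span A {x : N | ∃ r ∈ (⊥ : Ideal A).jacobson, ∃ m : N, x = r • m}

noncomputable section TensorHom

variable {K : Type} [Field K]
variable {Δ : Type} [Ring Δ] [Algebra K Δ] {Γ : Type} [Ring Γ] [Algebra K Γ]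
variable {P : Type} [AddCommGroup P] [Module K P] [Module Δ P] [IsScalarTower K Δ P]
variable {Q : Type} [AddCommGroup Q] [Module K Q] [Module Γ Q] [IsScalarTower K Γ Q]
variable {Q' : Type} [AddCommGroup Q'] [Module K Q'] [Module Γ Q'] [IsScalarTower K Γ Q']

/-- The regular module structure of `Δ ⊗[K] Γ`, given precedence over `tensorTensorModule`. -/
local instance (priority := 3000) regularTensorModule : Module (Δ ⊗[K] Γ) (Δ ⊗[K] Γ) :=
  Semiring.toModule

/-- An additive map out of `P ⊗[K] Q` which respects the action of pure tensors of `Δ ⊗[K] Γ`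
on pure tensors is `Δ ⊗[K] Γ`-linear. -/
def linearOfTmul {X : Type} [AddCommGroup X] [Module (Δ ⊗[K] Γ) X] (e : (P ⊗[K] Q) →+ X)
    (h : ∀ (δ : Δ) (γ : Γ) (p : P) (q : Q),
      e ((δ • p) ⊗ₜ[K] (γ • q)) = (δ ⊗ₜ[K] γ) • e (p ⊗ₜ[K] q)) :
    (P ⊗[K] Q) →ₗ[Δ ⊗[K] Γ] X where
  toFun := e
  map_add' := map_add e
  map_smul' c x := by
    rw [RingHom.id_apply]
    induction c using TensorProduct.induction_on with
    | zero => rw [zero_smul, zero_smul, map_zero]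
    | add c d hc hd => rw [add_smul, add_smul, map_add, hc, hd]
    | tmul δ γ =>
      induction x using TensorProduct.induction_on with
      | zero => rw [smul_zero, map_zero, smul_zero]
      | add x y hx hy => rw [smul_add, map_add, map_add, smul_add, hx, hy]
      | tmul p q => rw [tensorModule_smul_tmul, h]

/-- The tensor product `φ ⊗ ψ : P ⊗[K] Q → Δ ⊗[K] Γ` of linear forms. -/
def tensorForm (φ : P →ₗ[Δ] Δ) (ψ : Q →ₗ[Γ] Γ) : (P ⊗[K] Q) →ₗ[Δ ⊗[K] Γ] (Δ ⊗[K] Γ) :=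
  linearOfTmul (TensorProduct.map (φ.restrictScalars K) (ψ.restrictScalars K)).toAddMonoidHom
    fun δ γ p q => by
      simp [Algebra.TensorProduct.tmul_mul_tmul]

@[simp]
theorem tensorForm_tmul (φ : P →ₗ[Δ] Δ) (ψ : Q →ₗ[Γ] Γ) (p : P) (q : Q) :
    tensorForm (K := K) φ ψ (p ⊗ₜ[K] q) = φ p ⊗ₜ[K] ψ q := rfl

theorem tensor_hom_ext {X : Type} [AddCommGroup X] [Module (Δ ⊗[K] Γ) X]
    {h h' : (P ⊗[K] Q) →ₗ[Δ ⊗[K] Γ] X}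
    (H : ∀ p q, h (p ⊗ₜ[K] q) = h' (p ⊗ₜ[K] q)) : h = h' := by
  ext x
  induction x using TensorProduct.induction_on with
  | zero => rw [map_zero, map_zero]
  | add x y hx hy => rw [map_add, map_add, hx, hy]
  | tmul p q => exact H p q

variable (K Δ Γ P Q) in
/-- The natural map `Hom_Δ(P, Δ) ⊗ Hom_Γ(Q, Γ) → Hom_{Δ ⊗ Γ}(P ⊗ Q, Δ ⊗ Γ)`. -/
def tensorFormHom :
    ((P →ₗ[Δ] Δ) ⊗[K] (Q →ₗ[Γ] Γ)) →ₗ[K] ((P ⊗[K] Q) →ₗ[Δ ⊗[K] Γ] (Δ ⊗[K] Γ)) :=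
  TensorProduct.lift <| LinearMap.mk₂ K tensorForm
    (fun _ _ _ => tensor_hom_ext fun _ _ => TensorProduct.add_tmul _ _ _)
    (fun _ _ _ => tensor_hom_ext fun _ _ => rfl)
    (fun _ _ _ => tensor_hom_ext fun _ _ => TensorProduct.tmul_add _ _ _)
    (fun _ _ _ => tensor_hom_ext fun _ _ => TensorProduct.tmul_smul _ _ _)

@[simp]
theorem tensorFormHom_tmul (φ : P →ₗ[Δ] Δ) (ψ : Q →ₗ[Γ] Γ) :
    tensorFormHom K Δ Γ P Q (φ ⊗ₜ[K] ψ) = tensorForm φ ψ := rfl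

/-- For a linear form `φ` on `M`, the map `a ↦ φ · a`. -/
def opSmulForm (K : Type) [Field K] {A : Type} [Ring A] [Algebra K A] {M : Type} [AddCommGroup M]
    [Module A M] (φ : M →ₗ[A] A) : A →ₗ[K] (M →ₗ[A] A) where
  toFun a := MulOpposite.op a • φ
  map_add' a b := by rw [MulOpposite.op_add, add_smul]
  map_smul' k a := LinearMap.ext fun m => by
    simp

theorem opSmulForm_apply {A : Type} [Ring A] [Algebra K A] {M : Type} [AddCommGroup M]
    [Module A M] (φ : M →ₗ[A] A) (a : A) (m : M) :
    opSmulForm K φ a m = φ m * a := rfl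

theorem tensorFormHom_opSmulForm (φ : P →ₗ[Δ] Δ) (ψ : Q →ₗ[Γ] Γ) (c : Δ ⊗[K] Γ) (x : P ⊗[K] Q) :
    tensorFormHom K Δ Γ P Q (TensorProduct.map (opSmulForm K φ) (opSmulForm K ψ) c) x =
      tensorForm φ ψ x * c := by
  induction c using TensorProduct.induction_on with
  | zero => simp
  | add c d hc hd => rw [map_add, map_add, LinearMap.add_apply, hc, hd, mul_add]
  | tmul δ γ =>
    induction x using TensorProduct.induction_on with
    | zero => simp
    | add x y hx hy => rw [map_add, map_add, hx, hy, add_mul]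
    | tmul p q => simp [opSmulForm_apply, Algebra.TensorProduct.tmul_mul_tmul]

/-- The dual basis lemma for finitely generated projective modules. -/
theorem exists_dual_basis (A : Type) [Ring A] (M : Type) [AddCommGroup M] [Module A M]
    [Module.Finite A M] [Module.Projective A M] :
    ∃ (n : ℕ) (m : Fin n → M) (φ : Fin n → M →ₗ[A] A), ∀ x, ∑ i, φ i x • m i = x := by
  obtain ⟨n, f, g, -, -, h⟩ := Module.Finite.exists_comp_eq_id_of_projective A M
  refine ⟨n, fun i => f (Pi.single i 1), fun i => (LinearMap.proj i).comp g, fun x => ?_⟩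
  conv_rhs => rw [← LinearMap.id_apply (R := A) x, ← h, LinearMap.comp_apply,
    LinearMap.pi_apply_eq_sum_univ f (g x)]
  refine Finset.sum_congr rfl fun i _ => ?_
  simp only [LinearMap.comp_apply, LinearMap.proj_apply]
  congr 2
  ext j
  simp [Pi.single_apply, eq_comm]

theorem sum_opSmulForm {A : Type} [Ring A] [Algebra K A] {M : Type} [AddCommGroup M]
    [Module A M] {n : ℕ} {m : Fin n → M} {φ : Fin n → M →ₗ[A] A}
    (h : ∀ x, ∑ i, φ i x • m i = x) (ψ : M →ₗ[A] A) :
    ∑ i, opSmulForm K (φ i) (ψ (m i)) = ψ := by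
  ext x
  conv_rhs => rw [← h x]
  simp [opSmulForm_apply]

theorem tensorFormHom_bijective [Module.Finite Δ P] [Module.Projective Δ P]
    [Module.Finite Γ Q] [Module.Projective Γ Q] :
    Function.Bijective (tensorFormHom K Δ Γ P Q) := by
  obtain ⟨n, p, φ, hp⟩ := exists_dual_basis Δ P
  obtain ⟨l, q, ψ, hq⟩ := exists_dual_basis Γ Q
  let β (h : (P ⊗[K] Q) →ₗ[Δ ⊗[K] Γ] (Δ ⊗[K] Γ)) : (P →ₗ[Δ] Δ) ⊗[K] (Q →ₗ[Γ] Γ) :=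
    ∑ i, ∑ j, TensorProduct.map (opSmulForm K (φ i)) (opSmulForm K (ψ j)) (h (p i ⊗ₜ[K] q j))
  refine Function.bijective_iff_has_inverse.2 ⟨β, fun t => ?_, fun h => ?_⟩
  · induction t using TensorProduct.induction_on with
    | zero => simp [β]
    | add x y hx hy =>
      simp only [β, map_add, LinearMap.add_apply, Finset.sum_add_distrib] at hx hy ⊢
      rw [hx, hy]
    | tmul φ' ψ' =>
      simp only [β, tensorFormHom_tmul, tensorForm_tmul, TensorProduct.map_tmul,
        ← TensorProduct.tmul_sum, ← TensorProduct.sum_tmul, sum_opSmulForm hp, sum_opSmulForm hq]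
  · refine tensor_hom_ext fun x y => ?_
    conv_rhs => rw [← hp x, ← hq y]
    simp only [β, map_sum, LinearMap.sum_apply, tensorFormHom_opSmulForm, tensorForm_tmul,
      TensorProduct.sum_tmul, TensorProduct.tmul_sum, ← tensorModule_smul_tmul, map_smul,
      smul_eq_mul]
    exact Finset.sum_comm

variable (K Δ P) in
theorem finite_linearForm [FiniteDimensional K Δ] [Module.Finite Δ P] :
    Module.Finite K (P →ₗ[Δ] Δ) := by
  have : Module.Finite K P := Module.Finite.trans Δ P
  exact Module.Finite.of_injective (LinearMap.restrictScalarsₗ K Δ P Δ K)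
    (LinearMap.restrictScalars_injective K)

/-- The map `id ⊗ f : P ⊗[K] Q → P ⊗[K] Q'` as a `Δ ⊗[K] Γ`-linear map. -/
def lTensorHom (Δ : Type) [Ring Δ] [Algebra K Δ] (P : Type) [AddCommGroup P] [Module K P]
    [Module Δ P] [IsScalarTower K Δ P] (f : Q →ₗ[Γ] Q') :
    (P ⊗[K] Q) →ₗ[Δ ⊗[K] Γ] (P ⊗[K] Q') :=
  linearOfTmul ((f.restrictScalars K).lTensor P).toAddMonoidHom fun δ γ p q => by
    simp [tensorModule_smul_tmul]

@[simp]
theorem lTensorHom_tmul (f : Q →ₗ[Γ] Q') (p : P) (q : Q) :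
    lTensorHom (K := K) Δ P f (p ⊗ₜ[K] q) = p ⊗ₜ[K] f q := rfl

theorem precompHom_lTensorHom (f : Q →ₗ[Γ] Q') (φ : P →ₗ[Δ] Δ) (ψ : Q' →ₗ[Γ] Γ) :
    precompHom K (Δ ⊗[K] Γ) (lTensorHom Δ P f) (tensorForm φ ψ) = tensorForm φ (ψ.comp f) :=
  tensor_hom_ext fun _ _ => rfl

theorem exists_nakayama_tensor_equiv [FiniteDimensional K Δ] [FiniteDimensional K Γ]
    [Module.Finite Δ P] [Module.Projective Δ P] [Module.Finite Γ Q] [Module.Projective Γ Q] :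
    ∃ θ : (nakayama K Δ P ⊗[K] nakayama K Γ Q) ≃ₗ[K] nakayama K (Δ ⊗[K] Γ) (P ⊗[K] Q),
      ∀ x y φ ψ, θ (x ⊗ₜ[K] y) (tensorForm φ ψ) = x φ * y ψ := by
  have : Module.Finite K (P →ₗ[Δ] Δ) := finite_linearForm _ _ _
  have : Module.Finite K (Q →ₗ[Γ] Γ) := finite_linearForm _ _ _
  let α := LinearEquiv.ofBijective (tensorFormHom K Δ Γ P Q) tensorFormHom_bijective
  refine ⟨(TensorProduct.dualDistribEquiv K (P →ₗ[Δ] Δ) (Q →ₗ[Γ] Γ)).trans α.symm.dualMap,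
    fun x y φ ψ => ?_⟩
  have h : α.symm (tensorForm φ ψ) = φ ⊗ₜ[K] ψ :=
    α.symm_apply_eq.2 (tensorFormHom_tmul φ ψ).symm
  show TensorProduct.dualDistrib K _ _ (x ⊗ₜ[K] y) (α.symm (tensorForm φ ψ)) = _
  rw [h, TensorProduct.dualDistrib_apply]

theorem nakayama_tensor_ext [Module.Finite Δ P] [Module.Projective Δ P]
    [Module.Finite Γ Q] [Module.Projective Γ Q]
    {a b : nakayama K (Δ ⊗[K] Γ) (P ⊗[K] Q)}
    (h : ∀ φ ψ, a (tensorForm φ ψ) = b (tensorForm φ ψ)) : a = b := by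
  ext t
  obtain ⟨t, rfl⟩ := tensorFormHom_bijective.surjective t
  induction t using TensorProduct.induction_on with
  | zero => simp
  | add x y hx hy => rw [map_add, map_add, map_add, hx, hy]
  | tmul φ ψ => exact h φ ψ

theorem nakayama_smul_apply {A : Type} [Ring A] [Algebra K A] {M : Type} [AddCommGroup M]
    [Module A M] (a : A) (x : nakayama K A M) (φ : M →ₗ[A] A) :
    (a • x) φ = x (opSmulForm K φ a) := rfl

theorem opSmulForm_tensorForm (φ : P →ₗ[Δ] Δ) (ψ : Q →ₗ[Γ] Γ) (δ : Δ) (γ : Γ) :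
    opSmulForm K (tensorForm (K := K) φ ψ) (δ ⊗ₜ[K] γ) =
      tensorForm (opSmulForm K φ δ) (opSmulForm K ψ γ) :=
  tensor_hom_ext fun p q => by
    simp [opSmulForm_apply, Algebra.TensorProduct.tmul_mul_tmul]

end TensorHom

set_option maxSynthPendingDepth 3 in
/-- Let `Δ`, `Γ` be finite-dimensional algebras over a field `K`, let
`Λ = Δ ⊗_K Γ`, let `P` be a finitely generated projective left `Δ`-module, and let
`Q¹ →f Q⁰ → M → 0` be a minimal projective presentation of a finitely generated left
`Γ`-module `M`.  Then `ker (ν_Λ (id_P ⊗ f)) ≅ ν_Δ(P) ⊗_K ker (ν_Γ f)` as left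
`Λ`-modules, i.e. `τ_Λ(P ⊗_K M) ≅ ν_Δ(P) ⊗_K τ_Γ(M)`. -/
theorem tau_tensor
    (K : Type) [Field K]
    (Δ : Type) [Ring Δ] [Algebra K Δ] [FiniteDimensional K Δ]
    (Γ : Type) [Ring Γ] [Algebra K Γ] [FiniteDimensional K Γ]
    (P : Type) [AddCommGroup P] [Module K P] [Module Δ P] [IsScalarTower K Δ P]
    [Module.Finite Δ P] [Module.Projective Δ P]
    (M Q1 Q0 : Type)
    [AddCommGroup M] [Module K M] [Module Γ M] [IsScalarTower K Γ M] [Module.Finite Γ M]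
    [AddCommGroup Q1] [Module K Q1] [Module Γ Q1] [IsScalarTower K Γ Q1]
    [Module.Finite Γ Q1] [Module.Projective Γ Q1]
    [AddCommGroup Q0] [Module K Q0] [Module Γ Q0] [IsScalarTower K Γ Q0]
    [Module.Finite Γ Q0] [Module.Projective Γ Q0]
    (f : Q1 →ₗ[Γ] Q0) (g : Q0 →ₗ[Γ] M)
    (hsurj : Function.Surjective g)
    (hexact : Function.Exact f g)
    (hmin1 : LinearMap.range f ≤ radSubmodule Γ Q0)
    (hmin2 : LinearMap.ker f ≤ radSubmodule Γ Q1) :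
    ∃ F : (P ⊗[K] Q1) →ₗ[Δ ⊗[K] Γ] (P ⊗[K] Q0),
      (∀ (p : P) (q : Q1), F (p ⊗ₜ[K] q) = p ⊗ₜ[K] (f q)) ∧
      Nonempty
        ((LinearMap.ker (nakayamaMap K (Δ ⊗[K] Γ) F)) ≃ₗ[Δ ⊗[K] Γ]
          ((nakayama K Δ P) ⊗[K] (LinearMap.ker (nakayamaMap K Γ f)))) := by
  refine ⟨lTensorHom Δ P f, lTensorHom_tmul f, ?_⟩
  obtain ⟨θ₁, hθ₁⟩ := exists_nakayama_tensor_equiv (K := K) (Δ := Δ) (Γ := Γ) (P := P) (Q := Q1)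
  obtain ⟨θ₀, hθ₀⟩ := exists_nakayama_tensor_equiv (K := K) (Δ := Δ) (Γ := Γ) (P := P) (Q := Q0)
  let ν := (nakayamaMap K Γ f).restrictScalars K
  let ι := (LinearMap.ker (nakayamaMap K Γ f)).subtype.restrictScalars K
  have hι : Function.Injective ι := Subtype.val_injective
  have hex : Function.Exact ι ν := LinearMap.exact_subtype_ker_map (nakayamaMap K Γ f)
  have hex' : Function.Exact (ι.lTensor (nakayama K Δ P)) (ν.lTensor (nakayama K Δ P)) :=
    Module.Flat.lTensor_exact _ hex
  have hι' : Function.Injective (ι.lTensor (nakayama K Δ P)) :=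
    Module.Flat.lTensor_preserves_injective_linearMap _ hι
  have hnat : ∀ w, nakayamaMap K (Δ ⊗[K] Γ) (lTensorHom Δ P f) (θ₁ w) =
      θ₀ (ν.lTensor (nakayama K Δ P) w) := fun w => by
    induction w using TensorProduct.induction_on with
    | zero => simp only [map_zero]
    | add x y hx hy => simp only [map_add, hx, hy]
    | tmul x y =>
      refine nakayama_tensor_ext fun φ ψ => ?_
      rw [LinearMap.lTensor_tmul, hθ₀]
      exact (congrArg (θ₁ (x ⊗ₜ[K] y)) (precompHom_lTensorHom f φ ψ)).trans
        (hθ₁ x y φ (ψ.comp f))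
  let G : (nakayama K Δ P ⊗[K] LinearMap.ker (nakayamaMap K Γ f)) →ₗ[Δ ⊗[K] Γ]
      nakayama K (Δ ⊗[K] Γ) (P ⊗[K] Q1) :=
    linearOfTmul (θ₁.toLinearMap ∘ₗ ι.lTensor (nakayama K Δ P)).toAddMonoidHom fun δ γ x y =>
      nakayama_tensor_ext fun φ ψ => by
        rw [nakayama_smul_apply, opSmulForm_tensorForm]
        exact (hθ₁ (δ • x) (γ • y.1) φ ψ).trans
          (hθ₁ x y.1 (opSmulForm K φ δ) (opSmulForm K ψ γ)).symm
  have hG : ∀ w, G w = θ₁ (ι.lTensor (nakayama K Δ P) w) := fun _ => rfl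
  have hGinj : Function.Injective G := θ₁.injective.comp hι'
  have hrange : LinearMap.range G =
      LinearMap.ker (nakayamaMap K (Δ ⊗[K] Γ) (lTensorHom Δ P f)) := by
    ext z
    obtain ⟨w, rfl⟩ := θ₁.surjective z
    rw [LinearMap.mem_ker, hnat, LinearEquiv.map_eq_zero_iff, hex' w, LinearMap.mem_range]
    simp only [hG, EmbeddingLike.apply_eq_iff_eq, Set.mem_range]
  exact ⟨((LinearEquiv.ofInjective G hGinj).trans (LinearEquiv.ofEq _ _ hrange)).symm⟩
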